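/- Equivalence with the submodular flow problem (Proposition 1): (i) if φ is a feasible flow for the maximum-flow problem (8) on arc set A, then the extension φ' of φ to A' = A ∪ {(s,t),(t,s)} defined by φ'_{ts} = value(φ) and φ'_{st} = −value(φ) is feasible for the submodular flow problem (9), and its objective φ'_{ts} equals value(φ); (ii) conversely, if φ is feasible for the submodular flow problem (9), then its restriction to A is feasible for problem (8) and its value equals φ_{ts}. In particular the optimal values of the two problems coincide. -/

import Mathlib

open Finset

/-- Nodes of the auxiliary graph `N = {s} ⊎ {t} ⊎ V ⊎ {(Q,i)}`. -/
inductive Node (V : Type*) where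
  | s : Node V
  | t : Node V
  | vert : V → Node V
  | copy : Finset V → V → Node V
  deriving DecidableEq

variable {V : Type*} [Fintype V] [DecidableEq V]

/-- The value `value(φ) = ∑_{i∈V} φ_{si}` of a flow. -/
def flowValue (φ : Node V → Node V → ℝ) : ℝ :=
  ∑ i : V, φ Node.s (Node.vert i)

/-- Feasibility for the maximum-flow problem (8) on the arc set `A`:
antisymmetry on every arc of `A`, capacity constraints (`c_{si}` on `(s,i)`, `c_{it}`
on `(i,t)`, `0` on `(i,s)` and `(t,i)`, no constraint on internal arcs), flow
conservation at each `i ∈ V`, and `φ_Q ∈ B(f_Q)` for each `Q ∈ 𝒬`. -/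
def Feasible8 (𝒬 : Finset (Finset V)) (cs ct : V → ℝ)
    (f : Finset V → Finset V → ℝ) (φ : Node V → Node V → ℝ) : Prop :=
  (∀ i : V, φ Node.s (Node.vert i) = - φ (Node.vert i) Node.s) ∧
  (∀ i : V, φ (Node.vert i) Node.t = - φ Node.t (Node.vert i)) ∧
  (∀ Q ∈ 𝒬, ∀ i ∈ Q, φ (Node.vert i) (Node.copy Q i) = - φ (Node.copy Q i) (Node.vert i)) ∧
  (∀ i : V, φ Node.s (Node.vert i) ≤ cs i) ∧
  (∀ i : V, φ (Node.vert i) Node.s ≤ 0) ∧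
  (∀ i : V, φ (Node.vert i) Node.t ≤ ct i) ∧
  (∀ i : V, φ Node.t (Node.vert i) ≤ 0) ∧
  (∀ i : V, φ Node.s (Node.vert i) + φ Node.t (Node.vert i)
      + ∑ Q ∈ 𝒬.filter (fun Q => i ∈ Q), φ (Node.copy Q i) (Node.vert i) = 0) ∧
  (∀ Q ∈ 𝒬, (∀ S ⊆ Q, ∑ i ∈ S, φ (Node.vert i) (Node.copy Q i) ≤ f Q S) ∧
      (∑ i ∈ Q, φ (Node.vert i) (Node.copy Q i)) = 0)

/-- The set of valid nodes `N = {s,t} ∪ V ∪ {(Q,i) : Q ∈ 𝒬, i ∈ Q}`. -/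
def validNodes (𝒬 : Finset (Finset V)) : Finset (Node V) :=
  {Node.s, Node.t} ∪ Finset.univ.image Node.vert
    ∪ 𝒬.biUnion (fun Q => Q.image (Node.copy Q))

/-- The boundary `∂φ(u) = ∑_{(v,u)∈A'} φ_{vu}` of a flow on `A' = A ∪ {(s,t),(t,s)}`. -/
def boundary (𝒬 : Finset (Finset V)) (ψ : Node V → Node V → ℝ) : Node V → ℝ
  | Node.s => (∑ i : V, ψ (Node.vert i) Node.s) + ψ Node.t Node.s
  | Node.t => (∑ i : V, ψ (Node.vert i) Node.t) + ψ Node.s Node.t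
  | Node.vert i => ψ Node.s (Node.vert i) + ψ Node.t (Node.vert i)
      + ∑ Q ∈ 𝒬.filter (fun Q => i ∈ Q), ψ (Node.copy Q i) (Node.vert i)
  | Node.copy Q i =>
      if Q ∈ 𝒬 ∧ i ∈ Q then ψ (Node.vert i) (Node.copy Q i) else 0

/-- The submodular function `g(X) = ∑_{Q∈𝒬} f_Q({ i ∈ Q : (Q,i) ∈ X })`. -/
def gFun (𝒬 : Finset (Finset V)) (f : Finset V → Finset V → ℝ)
    (X : Finset (Node V)) : ℝ :=
  ∑ Q ∈ 𝒬, f Q (Q.filter fun i => Node.copy Q i ∈ X)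

/-- Feasibility for the submodular flow problem (9) on `A'`: antisymmetry on every arc,
capacity constraints (including `φ_{st} ≤ 0`), and `∂φ ∈ B(g)`. -/
def Feasible9 (𝒬 : Finset (Finset V)) (cs ct : V → ℝ)
    (f : Finset V → Finset V → ℝ) (ψ : Node V → Node V → ℝ) : Prop :=
  (∀ i : V, ψ Node.s (Node.vert i) = - ψ (Node.vert i) Node.s) ∧
  (∀ i : V, ψ (Node.vert i) Node.t = - ψ Node.t (Node.vert i)) ∧
  (∀ Q ∈ 𝒬, ∀ i ∈ Q, ψ (Node.vert i) (Node.copy Q i) = - ψ (Node.copy Q i) (Node.vert i)) ∧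
  (ψ Node.s Node.t = - ψ Node.t Node.s) ∧
  (∀ i : V, ψ Node.s (Node.vert i) ≤ cs i) ∧
  (∀ i : V, ψ (Node.vert i) Node.s ≤ 0) ∧
  (∀ i : V, ψ (Node.vert i) Node.t ≤ ct i) ∧
  (∀ i : V, ψ Node.t (Node.vert i) ≤ 0) ∧
  (ψ Node.s Node.t ≤ 0) ∧
  (∀ X : Finset (Node V), X ⊆ validNodes 𝒬 →
      ∑ u ∈ X, boundary 𝒬 ψ u ≤ gFun 𝒬 f X) ∧
  (∑ u ∈ validNodes 𝒬, boundary 𝒬 ψ u = 0)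

/-- The extension of a flow `φ` on `A` to `A'` by `φ'_{ts} = value(φ)`,
`φ'_{st} = −value(φ)`. -/
def extendFlow (φ : Node V → Node V → ℝ) : Node V → Node V → ℝ :=
  fun u v =>
    if u = Node.t ∧ v = Node.s then flowValue φ
    else if u = Node.s ∧ v = Node.t then - flowValue φ
    else φ u v

lemma sum_boundary_eq (𝒬 : Finset (Finset V)) (ψ : Node V → Node V → ℝ)
    (hs : boundary 𝒬 ψ Node.s = 0) (ht : boundary 𝒬 ψ Node.t = 0)
    (hv : ∀ i, boundary 𝒬 ψ (Node.vert i) = 0) (X : Finset (Node V)) :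
    ∑ u ∈ X, boundary 𝒬 ψ u
      = ∑ Q ∈ 𝒬, ∑ i ∈ Q.filter (fun i => Node.copy Q i ∈ X),
          ψ (Node.vert i) (Node.copy Q i) := by
  have h1 : ∑ u ∈ 𝒬.biUnion (fun Q =>
        (Q.filter (fun i => Node.copy Q i ∈ X)).image (Node.copy Q)), boundary 𝒬 ψ u
      = ∑ u ∈ X, boundary 𝒬 ψ u := by
    apply Finset.sum_subset
    · intro u hu
      simp only [Finset.mem_biUnion, Finset.mem_image, Finset.mem_filter] at hu
      obtain ⟨Q, _, i, ⟨_, h⟩, rfl⟩ := hu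
      exact h
    · intro u hu hn
      cases u with
      | s => exact hs
      | t => exact ht
      | vert i => exact hv i
      | copy Q i =>
        simp only [boundary]
        rw [if_neg]
        rintro ⟨hQ, hi⟩
        apply hn
        simp only [Finset.mem_biUnion, Finset.mem_image, Finset.mem_filter]
        exact ⟨Q, hQ, i, ⟨hi, hu⟩, rfl⟩
  rw [← h1, Finset.sum_biUnion]
  · refine Finset.sum_congr rfl fun Q hQ => ?_
    rw [Finset.sum_image]
    · refine Finset.sum_congr rfl fun i hi => ?_
      simp only [boundary]
      rw [if_pos ⟨hQ, (Finset.mem_filter.mp hi).1⟩]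
    · intro a _ b _ h
      injection h
  · intro Q _ Q' _ hne
    simp only [Function.onFun]
    rw [Finset.disjoint_left]
    intro u hu hu'
    simp only [Finset.mem_image] at hu hu'
    obtain ⟨i, _, rfl⟩ := hu
    obtain ⟨j, _, h⟩ := hu'
    injection h with h1 h2
    exact hne h1.symm

lemma sum_copy_comm (𝒬 : Finset (Finset V)) (F : Finset V → V → ℝ) :
    ∑ i : V, ∑ Q ∈ 𝒬.filter (fun Q => i ∈ Q), F Q i = ∑ Q ∈ 𝒬, ∑ i ∈ Q, F Q i := by
  apply Finset.sum_comm'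
  intro i Q
  simp [and_comm]

lemma copy_mem_valid (𝒬 : Finset (Finset V)) (Q : Finset V) (i : V) :
    Node.copy Q i ∈ validNodes 𝒬 ↔ Q ∈ 𝒬 ∧ i ∈ Q := by
  simp only [validNodes, Finset.mem_union, Finset.mem_insert, Finset.mem_singleton,
    Finset.mem_image, Finset.mem_biUnion]
  constructor
  · rintro ((h | h) | h)
    · rcases h with h | h <;> cases h
    · obtain ⟨_, _, h⟩ := h
      cases h
    · obtain ⟨Q', hQ, j, hj, h⟩ := h
      cases h
      exact ⟨hQ, hj⟩
  · rintro ⟨hQ, hi⟩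
    exact Or.inr ⟨Q, hQ, i, hi, rfl⟩

lemma sum_zero_of_compl (𝒬 : Finset (Finset V)) (f : Finset V → Finset V → ℝ)
    (b : Node V → ℝ)
    (hb : ∀ X : Finset (Node V), X ⊆ validNodes 𝒬 → ∑ u ∈ X, b u ≤ gFun 𝒬 f X)
    (hN : ∑ u ∈ validNodes 𝒬, b u = 0)
    (hempty : ∀ Q ∈ 𝒬, f Q ∅ = 0) (hfull : ∀ Q ∈ 𝒬, f Q Q = 0)
    (X : Finset (Node V)) (hX : X ⊆ validNodes 𝒬)
    (h : ∀ Q ∈ 𝒬, (∀ i ∈ Q, Node.copy Q i ∈ X) ∨ (∀ i ∈ Q, Node.copy Q i ∉ X)) :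
    ∑ u ∈ X, b u = 0 := by
  have h1 : gFun 𝒬 f X = 0 := by
    apply Finset.sum_eq_zero
    intro Q hQ
    rcases h Q hQ with h | h
    · rw [Finset.filter_true_of_mem h, hfull Q hQ]
    · rw [Finset.filter_false_of_mem h, hempty Q hQ]
  have h2 : gFun 𝒬 f (validNodes 𝒬 \ X) = 0 := by
    apply Finset.sum_eq_zero
    intro Q hQ
    rcases h Q hQ with h | h
    · rw [Finset.filter_false_of_mem, hempty Q hQ]
      intro i hi hm
      exact (Finset.mem_sdiff.mp hm).2 (h i hi)
    · rw [Finset.filter_true_of_mem, hfull Q hQ]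
      intro i hi
      exact Finset.mem_sdiff.mpr ⟨(copy_mem_valid 𝒬 Q i).2 ⟨hQ, hi⟩, h i hi⟩
  have h3 := hb X hX
  have h4 := hb (validNodes 𝒬 \ X) Finset.sdiff_subset
  have h5 := Finset.sum_sdiff (f := b) hX
  linarith

/-- Proposition 1 (equivalence with the submodular flow problem): (i) the extension of a
feasible flow for problem (8) is feasible for the submodular flow problem (9) with
objective `φ'_{ts} = value(φ)`; (ii) conversely, the restriction to `A` of a feasible
flow for (9) is feasible for (8) and its value equals `φ_{ts}`. -/
theorem submodular_flow_equivalence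
    (𝒬 : Finset (Finset V)) (cs ct : V → ℝ) (f : Finset V → Finset V → ℝ)
    (hQcard : ∀ Q ∈ 𝒬, 2 ≤ Q.card)
    (hcs : ∀ i, 0 ≤ cs i) (hct : ∀ i, 0 ≤ ct i)
    (hsub : ∀ Q ∈ 𝒬, ∀ S ⊆ Q, ∀ T ⊆ Q, f Q (S ∪ T) + f Q (S ∩ T) ≤ f Q S + f Q T)
    (hempty : ∀ Q ∈ 𝒬, f Q ∅ = 0) (hfull : ∀ Q ∈ 𝒬, f Q Q = 0) :
    (∀ φ : Node V → Node V → ℝ, Feasible8 𝒬 cs ct f φ →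
        Feasible9 𝒬 cs ct f (extendFlow φ) ∧
        extendFlow φ Node.t Node.s = flowValue φ) ∧
    (∀ ψ : Node V → Node V → ℝ, Feasible9 𝒬 cs ct f ψ →
        Feasible8 𝒬 cs ct f ψ ∧ flowValue ψ = ψ Node.t Node.s) := by
  constructor
  · intro φ h
    obtain ⟨as, at', aq, c1, c2, c3, c4, cons, hB⟩ := h
    have ets : extendFlow φ Node.t Node.s = flowValue φ := by simp [extendFlow]
    have est : extendFlow φ Node.s Node.t = - flowValue φ := by simp [extendFlow]
    have evl : ∀ i u, extendFlow φ (Node.vert i) u = φ (Node.vert i) u := by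
      intro i u; simp [extendFlow]
    have evr : ∀ i u, extendFlow φ u (Node.vert i) = φ u (Node.vert i) := by
      intro i u; simp [extendFlow]
    have hs : boundary 𝒬 (extendFlow φ) Node.s = 0 := by
      simp only [boundary, evl, ets, flowValue, as, Finset.sum_neg_distrib]
      ring
    have hv : ∀ i, boundary 𝒬 (extendFlow φ) (Node.vert i) = 0 := by
      intro i
      simp only [boundary, evr]
      exact cons i
    have ht : boundary 𝒬 (extendFlow φ) Node.t = 0 := by
      simp only [boundary, evl, est, flowValue, at', Finset.sum_neg_distrib]
      have h0 := Finset.sum_eq_zero (s := Finset.univ) (fun i _ => cons i)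
      rw [Finset.sum_add_distrib, Finset.sum_add_distrib,
        sum_copy_comm 𝒬 (fun Q i => φ (Node.copy Q i) (Node.vert i))] at h0
      have h1 : ∑ Q ∈ 𝒬, ∑ i ∈ Q, φ (Node.copy Q i) (Node.vert i) = 0 := by
        apply Finset.sum_eq_zero
        intro Q hQ
        have h2 := (hB Q hQ).2
        rw [Finset.sum_congr rfl (fun i hi => aq Q hQ i hi), Finset.sum_neg_distrib] at h2
        linarith
      linarith
    have hsum := sum_boundary_eq 𝒬 (extendFlow φ) hs ht hv
    simp only [evl] at hsum
    refine ⟨⟨?_, ?_, ?_, ?_, ?_, ?_, ?_, ?_, ?_, ?_, ?_⟩, ets⟩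
    · simpa only [evl, evr] using as
    · simpa only [evl, evr] using at'
    · simpa only [evl, evr] using aq
    · rw [est, ets]
    · simpa only [evl, evr] using c1
    · simpa only [evl, evr] using c2
    · simpa only [evl, evr] using c3
    · simpa only [evl, evr] using c4
    · rw [est, neg_nonpos]
      apply Finset.sum_nonneg
      intro i _
      linarith [as i, c2 i]
    · intro X _
      rw [hsum]
      exact Finset.sum_le_sum fun Q hQ => (hB Q hQ).1 _ (Finset.filter_subset _ _)
    · rw [hsum]
      apply Finset.sum_eq_zero
      intro Q hQ
      rw [Finset.filter_true_of_mem fun i hi => (copy_mem_valid 𝒬 Q i).2 ⟨hQ, hi⟩]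
      exact (hB Q hQ).2
  · intro ψ h
    obtain ⟨as, at', aq, ast, c1, c2, c3, c4, _, hb, hN⟩ := h
    have key := sum_zero_of_compl 𝒬 f _ hb hN hempty hfull
    have hs : boundary 𝒬 ψ Node.s = 0 := by
      have := key {Node.s} (by simp [validNodes]) (fun Q _ => Or.inr (by simp))
      simpa using this
    have hv : ∀ i, boundary 𝒬 ψ (Node.vert i) = 0 := by
      intro i
      have := key {Node.vert i} (by simp [validNodes]) (fun Q _ => Or.inr (by simp))
      simpa using this
    have himg : ∀ Q ∈ 𝒬, ∀ S ⊆ Q, S.image (Node.copy Q) ⊆ validNodes 𝒬 := by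
      intro Q hQ S hS u hu
      obtain ⟨i, hi, rfl⟩ := Finset.mem_image.mp hu
      exact (copy_mem_valid 𝒬 Q i).2 ⟨hQ, hS hi⟩
    have hsumS : ∀ Q ∈ 𝒬, ∀ S ⊆ Q, ∑ u ∈ S.image (Node.copy Q), boundary 𝒬 ψ u
        = ∑ i ∈ S, ψ (Node.vert i) (Node.copy Q i) := by
      intro Q hQ S hS
      rw [Finset.sum_image]
      · refine Finset.sum_congr rfl fun i hi => ?_
        simp only [boundary]
        rw [if_pos ⟨hQ, hS hi⟩]
      · intro a _ b _ h
        injection h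
    refine ⟨⟨as, at', aq, c1, c2, c3, c4, ?_, ?_⟩, ?_⟩
    · intro i
      exact hv i
    · intro Q hQ
      constructor
      · intro S hS
        have h1 := hb _ (himg Q hQ S hS)
        rw [hsumS Q hQ S hS] at h1
        refine h1.trans (le_of_eq ?_)
        unfold gFun
        rw [Finset.sum_eq_single Q]
        · congr 1
          ext i
          simp only [Finset.mem_filter, Finset.mem_image, Node.copy.injEq, true_and,
            exists_eq_right]
          exact ⟨fun h => h.2, fun h => ⟨hS h, h⟩⟩
        · intro Q' hQ' hne
          rw [Finset.filter_false_of_mem, hempty Q' hQ']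
          intro i _ hm
          obtain ⟨j, _, h⟩ := Finset.mem_image.mp hm
          injection h with h1 _
          exact hne h1.symm
        · intro h
          exact absurd hQ h
      · rw [← hsumS Q hQ Q (Finset.Subset.refl Q)]
        apply key _ (himg Q hQ Q (Finset.Subset.refl Q))
        intro Q' _
        by_cases hne : Q' = Q
        · left
          intro i hi
          rw [hne] at hi ⊢
          exact Finset.mem_image_of_mem _ hi
        · right
          intro i _ hm
          obtain ⟨j, _, h⟩ := Finset.mem_image.mp hm
          injection h with h1 _
          exact hne h1.symm
    · simp only [boundary] at hs
      simp only [flowValue, as, Finset.sum_neg_distrib]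
      linarith
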